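/- Let (V,q) be a quadratic space over ℚ₂ of dimension d ≥ 3, let L be an odd unimodular lattice in (V,q), and let Λ = {x ∈ L : q(x) ∈ 2ℤ₂}. If (V,q) contains an even unimodular lattice, then Λ is not a maximal lattice in (V, ½q), and there exists an even unimodular lattice L_even in (V,q) such that Λ = L ∩ L_even and the index [L_even : Λ] of Λ in L_even equals 2. -/

import Mathlib

/-- The symmetric bilinear form `B_q(x,y) = (q(x+y) - q(x) - q(y))/2` associated to a
quadratic form `q` on a `ℚ₂`-vector space `V`. -/
noncomputable def Bq {V : Type*} [AddCommGroup V] [Module ℚ_[2] V]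
    (q : QuadraticForm ℚ_[2] V) (x y : V) : ℚ_[2] :=
  (q (x + y) - q x - q y) / 2

/-- An element `c : ℚ₂` lies in `ℤ₂ ⊆ ℚ₂` iff its 2-adic norm is at most 1. -/
def IsIntegral2 (c : ℚ_[2]) : Prop := ‖c‖ ≤ 1

/-- A lattice in a `ℚ₂`-vector space `V`: a finitely generated `ℤ₂`-submodule
that spans `V` over `ℚ₂`. -/
def IsLattice {V : Type*} [AddCommGroup V] [Module ℚ_[2] V] [Module ℤ_[2] V]
    [IsScalarTower ℤ_[2] ℚ_[2] V] (L : Submodule ℤ_[2] V) : Prop :=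
  L.FG ∧ Submodule.span ℚ_[2] (L : Set V) = ⊤

/-- `x` lies in the dual lattice `L* = {x ∈ V : B_q(x, L) ⊆ ℤ₂}` of `L`. -/
def InDual {V : Type*} [AddCommGroup V] [Module ℚ_[2] V] [Module ℤ_[2] V]
    [IsScalarTower ℤ_[2] ℚ_[2] V] (q : QuadraticForm ℚ_[2] V) (L : Submodule ℤ_[2] V)
    (x : V) : Prop :=
  ∀ y ∈ L, IsIntegral2 (Bq q x y)

/-- `L` is unimodular: the dual lattice `L*` equals `L`. -/
def IsUnimodular {V : Type*} [AddCommGroup V] [Module ℚ_[2] V] [Module ℤ_[2] V]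
    [IsScalarTower ℤ_[2] ℚ_[2] V] (q : QuadraticForm ℚ_[2] V) (L : Submodule ℤ_[2] V) : Prop :=
  ∀ x : V, InDual q L x ↔ x ∈ L

/-- A lattice `L` is even when `q(L) ⊆ 2ℤ₂`; a unimodular lattice is odd when it is not even. -/
def IsEvenLat {V : Type*} [AddCommGroup V] [Module ℚ_[2] V] [Module ℤ_[2] V]
    [IsScalarTower ℤ_[2] ℚ_[2] V] (q : QuadraticForm ℚ_[2] V) (L : Submodule ℤ_[2] V) : Prop :=
  ∀ x ∈ L, IsIntegral2 (q x / 2)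

/-- `L` is a maximal lattice for the form `q'` on `V`: `q'` takes values in `ℤ₂` on `L`
and on no lattice strictly containing `L`. -/
def IsMaximalLat {V : Type*} [AddCommGroup V] [Module ℚ_[2] V] [Module ℤ_[2] V]
    [IsScalarTower ℤ_[2] ℚ_[2] V] (q' : V → ℚ_[2]) (L : Submodule ℤ_[2] V) : Prop :=
  (∀ x ∈ L, IsIntegral2 (q' x)) ∧
    ∀ M : Submodule ℤ_[2] V, IsLattice M → L < M → ¬ (∀ x ∈ M, IsIntegral2 (q' x))

lemma PadicInt.coe_two : ((2 : ℤ_[2]) : ℚ_[2]) = 2 :=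
  map_ofNat PadicInt.Coe.ringHom 2

namespace IsIntegral2

lemma add {a b : ℚ_[2]} (ha : IsIntegral2 a) (hb : IsIntegral2 b) : IsIntegral2 (a + b) :=
  (PadicInt.subring 2).add_mem ha hb

lemma sub {a b : ℚ_[2]} (ha : IsIntegral2 a) (hb : IsIntegral2 b) : IsIntegral2 (a - b) :=
  (PadicInt.subring 2).sub_mem ha hb

lemma mul {a b : ℚ_[2]} (ha : IsIntegral2 a) (hb : IsIntegral2 b) : IsIntegral2 (a * b) :=
  (PadicInt.subring 2).mul_mem ha hb

lemma coe (a : ℤ_[2]) : IsIntegral2 (a : ℚ_[2]) := a.2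

lemma two : IsIntegral2 2 := by
  exact PadicInt.coe_two ▸ coe 2

lemma mem_one_iff {c : ℚ_[2]} : c ∈ (1 : Submodule ℤ_[2] ℚ_[2]) ↔ IsIntegral2 c := by
  rw [Submodule.mem_one]
  exact ⟨by rintro ⟨a, rfl⟩; exact coe a, fun h => ⟨⟨c, h⟩, rfl⟩⟩

end IsIntegral2

/-- Every 2-adic integer is even or odd. -/
lemma PadicInt.exists_eq_two_mul_or (a : ℤ_[2]) : ∃ b : ℤ_[2], a = 2 * b ∨ a = 2 * b + 1 := by
  obtain ⟨n, hn, h⟩ := PadicInt.exists_mem_range a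
  rw [PadicInt.maximalIdeal_eq_span_p, Ideal.mem_span_singleton] at h
  obtain ⟨b, hb⟩ := h
  refine ⟨b, ?_⟩
  interval_cases n
  · left; simpa using hb
  · right; rw [← sub_eq_iff_eq_add]; simpa using hb

/-- The sum of two elements of `½ℤ₂ \ ℤ₂` is in `ℤ₂`. -/
lemma IsIntegral2.add_of_two_mul {c e : ℚ_[2]} (hc : IsIntegral2 (2 * c)) (hc' : ¬ IsIntegral2 c)
    (he : IsIntegral2 (2 * e)) (he' : ¬ IsIntegral2 e) : IsIntegral2 (c + e) := by
  have odd : ∀ {c : ℚ_[2]}, IsIntegral2 (2 * c) → ¬ IsIntegral2 c →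
      ∃ b : ℤ_[2], 2 * c = 2 * (b : ℚ_[2]) + 1 := by
    intro c hc hc'
    obtain ⟨b, hb | hb⟩ := PadicInt.exists_eq_two_mul_or ⟨2 * c, hc⟩
    · have h : 2 * c = 2 * (b : ℚ_[2]) :=
        (congrArg Subtype.val hb).trans (by rw [PadicInt.coe_mul, PadicInt.coe_two])
      exact absurd (mul_left_cancel₀ two_ne_zero h ▸ IsIntegral2.coe b) hc'
    · exact ⟨b, (congrArg Subtype.val hb).trans (by simp [PadicInt.coe_two])⟩
  obtain ⟨a, ha⟩ := odd hc hc'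
  obtain ⟨b, hb⟩ := odd he he'
  have h : c + e = ((a + b + 1 : ℤ_[2]) : ℚ_[2]) := by
    push_cast
    linear_combination (ha + hb) / 2
  exact h ▸ IsIntegral2.coe _

/-- If `2v ∈ Λ`, every element of `Λ + ℤ₂v` lies in `Λ` or in `v + Λ`. -/
lemma mem_or_sub_mem_of_mem_sup_span {V : Type*} [AddCommGroup V]
    [Module ℤ_[2] V] {Λ : Submodule ℤ_[2] V} {v x : V}
    (h2v : (2 : ℤ_[2]) • v ∈ Λ) (hx : x ∈ Λ ⊔ Submodule.span ℤ_[2] {v}) :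
    x ∈ Λ ∨ x - v ∈ Λ := by
  obtain ⟨y, hy, z, hz, rfl⟩ := Submodule.mem_sup.1 hx
  obtain ⟨a, rfl⟩ := Submodule.mem_span_singleton.1 hz
  obtain ⟨b, rfl | rfl⟩ := PadicInt.exists_eq_two_mul_or a
  · left
    rw [mul_comm, mul_smul]
    exact Λ.add_mem hy (Λ.smul_mem _ h2v)
  · right
    rw [add_smul, one_smul, ← add_assoc, add_sub_cancel_right, mul_comm, mul_smul]
    exact Λ.add_mem hy (Λ.smul_mem _ h2v)

/-- If `2v ∈ Λ` and `v ∉ Λ`, then `Λ` has index two in `Λ + ℤ₂v`. -/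
lemma card_quotient_sup_span_eq_two {V : Type*} [AddCommGroup V] [Module ℤ_[2] V]
    {Λ : Submodule ℤ_[2] V} {v : V}
    (h2v : (2 : ℤ_[2]) • v ∈ Λ) (hv : v ∉ Λ) :
    Nat.card (↥(Λ ⊔ Submodule.span ℤ_[2] {v}) ⧸
      Submodule.comap (Λ ⊔ Submodule.span ℤ_[2] {v}).subtype Λ) = 2 := by
  have hvM : v ∈ Λ ⊔ Submodule.span ℤ_[2] {v} :=
    le_sup_right (a := Λ) (Submodule.mem_span_singleton_self v)
  rw [Nat.card_eq_two_iff]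
  refine ⟨0, Submodule.Quotient.mk ⟨v, hvM⟩, ?_, ?_⟩
  · intro h
    rw [eq_comm, Submodule.Quotient.mk_eq_zero] at h
    exact hv h
  · refine Set.eq_univ_of_forall fun z => ?_
    obtain ⟨x, rfl⟩ := Submodule.Quotient.mk_surjective _ z
    rcases mem_or_sub_mem_of_mem_sup_span h2v x.2 with h | h
    · left
      exact (Submodule.Quotient.mk_eq_zero _).2 h
    · right
      exact (Submodule.Quotient.eq _).2 h

section Lattices

variable {V : Type*} [AddCommGroup V] [Module ℚ_[2] V] {q : QuadraticForm ℚ_[2] V}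

lemma associated_eq_Bq (x y : V) : QuadraticMap.associated q x y = Bq q x y := by
  have h := LinearMap.congr_fun₂ (QuadraticMap.two_nsmul_associated ℚ_[2] q) x y
  simp only [LinearMap.smul_apply, nsmul_eq_mul, QuadraticMap.polarBilin_apply_apply,
    QuadraticMap.polar] at h
  rw [Bq, ← h]
  simp

lemma Bq_comm (x y : V) : Bq q x y = Bq q y x := by
  rw [Bq, Bq, add_comm]
  ring

lemma Bq_add_left (x y z : V) : Bq q (x + y) z = Bq q x z + Bq q y z := by
  simp [← associated_eq_Bq]

lemma Bq_smul_left (a : ℚ_[2]) (x y : V) : Bq q (a • x) y = a * Bq q x y := by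
  simp [← associated_eq_Bq]

lemma Bq_add_right (x y z : V) : Bq q x (y + z) = Bq q x y + Bq q x z := by
  simp [← associated_eq_Bq]

lemma Bq_smul_right (a : ℚ_[2]) (x y : V) : Bq q x (a • y) = a * Bq q x y := by
  simp [← associated_eq_Bq]

lemma map_add_eq_Bq (x y : V) : q (x + y) = q x + q y + 2 * Bq q x y := by
  rw [Bq]
  ring

lemma Bq_self (x : V) : Bq q x x = q x := by
  have := QuadraticMap.map_smul q (2 : ℚ_[2]) x
  rw [Bq, ← two_smul ℚ_[2] x, this, smul_eq_mul]
  ring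

lemma IsIntegral2.half_map_add {x y : V} (hx : IsIntegral2 (q x / 2)) (hy : IsIntegral2 (q y / 2))
    (hxy : IsIntegral2 (Bq q x y)) : IsIntegral2 (q (x + y) / 2) := by
  have h : q (x + y) / 2 = q x / 2 + q y / 2 + Bq q x y := by
    rw [map_add_eq_Bq]
    ring
  exact h ▸ (hx.add hy).add hxy

variable [Module ℤ_[2] V] [IsScalarTower ℤ_[2] ℚ_[2] V]

lemma padicInt_smul_eq (a : ℤ_[2]) (x : V) : a • x = (a : ℚ_[2]) • x :=
  (algebraMap_smul ℚ_[2] a x).symm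

lemma IsIntegral2.half_map_smul (a : ℤ_[2]) {x : V} (hx : IsIntegral2 (q x / 2)) :
    IsIntegral2 (q (a • x) / 2) := by
  rw [padicInt_smul_eq, QuadraticMap.map_smul, smul_eq_mul, mul_div_assoc]
  exact ((IsIntegral2.coe a).mul (IsIntegral2.coe a)).mul hx

/-- Lattices for a nondegenerate form are reflexive: the double dual of `N` is contained in `N`. -/
lemma IsLattice.mem_of_forall_inDual (hnd : ∀ x : V, (∀ y : V, Bq q x y = 0) → x = 0)
    {N : Submodule ℤ_[2] V} (hN : IsLattice N) {u : V}
    (hu : ∀ y, InDual q N y → IsIntegral2 (Bq q u y)) : u ∈ N := by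
  have : Submodule.IsLattice ℚ_[2] N := ⟨hN.1, hN.2⟩
  have hB : (QuadraticMap.associated q).Nondegenerate := by
    refine ⟨fun x hx => hnd x fun y => ?_, fun x hx => hnd x fun y => ?_⟩
    · rw [← associated_eq_Bq, hx]
    · rw [Bq_comm, ← associated_eq_Bq, hx]
  have hs : LinearMap.BilinForm.IsSymm (QuadraticMap.associated q) :=
    ⟨fun x y => QuadraticMap.associated_isSymm ℚ_[2] q x y⟩
  let b := Module.Free.chooseBasis ℤ_[2] N
  have hspan : Submodule.span ℤ_[2] (Set.range (b.extendOfIsLattice ℚ_[2])) = N := by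
    have h : Set.range (b.extendOfIsLattice ℚ_[2]) = N.subtype '' Set.range b := by
      rw [← Set.range_comp]
      congr 1
      ext i
      simp
    rw [h, ← Submodule.map_span, b.span_eq, Submodule.map_top, Submodule.range_subtype]
  rw [← hspan, ← LinearMap.BilinForm.dualSubmodule_dualSubmodule_of_basis (R := ℤ_[2])
    (QuadraticMap.associated q) hB hs, hspan]
  intro y hy
  rw [IsIntegral2.mem_one_iff, associated_eq_Bq]
  refine hu y fun z hz => ?_
  rw [← associated_eq_Bq, ← IsIntegral2.mem_one_iff]
  exact hy z hz

lemma IsLattice.sup {M N : Submodule ℤ_[2] V} (hM : IsLattice M) (hN : IsLattice N) :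
    IsLattice (M ⊔ N) :=
  ⟨hM.1.sup hN.1, eq_top_iff.mpr (hM.2 ▸ Submodule.span_mono (le_sup_left (a := M)))⟩

/-- The dual of an intersection of two unimodular lattices is contained in their sum. -/
lemma IsUnimodular.mem_sup_of_inDual_inf (hnd : ∀ x : V, (∀ y : V, Bq q x y = 0) → x = 0)
    {L L' : Submodule ℤ_[2] V} (hL : IsLattice L) (hL' : IsLattice L')
    (hLu : IsUnimodular q L) (hLu' : IsUnimodular q L') {u : V} (hu : InDual q (L ⊓ L') u) :
    u ∈ L ⊔ L' :=
  (hL.sup hL').mem_of_forall_inDual hnd fun y hy => hu y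
    ⟨(hLu y).1 fun z hz => hy z (le_sup_left (a := L) hz),
      (hLu' y).1 fun z hz => hy z (le_sup_right (a := L) hz)⟩

/-- A submodule between `2L` and a lattice `L` is a lattice. -/
lemma IsLattice.of_two_smul_mem {L Λ : Submodule ℤ_[2] V} (hL : IsLattice L) (hle : Λ ≤ L)
    (h2 : ∀ x ∈ L, (2 : ℤ_[2]) • x ∈ Λ) : IsLattice Λ := by
  refine ⟨?_, ?_⟩
  · have : Module.Finite ℤ_[2] L := Module.Finite.iff_fg.2 hL.1
    have : IsNoetherian ℤ_[2] Λ := isNoetherian_of_le hle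
    exact Module.Finite.iff_fg.1 inferInstance
  · rw [eq_top_iff, ← hL.2, Submodule.span_le]
    intro x hx
    have h : x = (2⁻¹ : ℚ_[2]) • ((2 : ℤ_[2]) • x) := by
      rw [two_smul ℤ_[2] x, ← two_smul ℚ_[2] x, smul_smul]
      norm_num
    rw [h]
    exact Submodule.smul_mem _ _ (Submodule.subset_span (h2 x hx))

variable {L Λ : Submodule ℤ_[2] V}

lemma IsUnimodular.isIntegral2_Bq (hLu : IsUnimodular q L) {x y : V} (hx : x ∈ L) (hy : y ∈ L) :
    IsIntegral2 (Bq q x y) :=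
  (hLu x).2 hx y hy

lemma IsUnimodular.isIntegral2_map (hLu : IsUnimodular q L) {x : V} (hx : x ∈ L) :
    IsIntegral2 (q x) :=
  Bq_self (q := q) x ▸ hLu.isIntegral2_Bq hx hx

/-- On a lattice with integral form, doubling lands in the even sublattice. -/
lemma IsUnimodular.isIntegral2_half_two_smul (hLu : IsUnimodular q L) {x : V} (hx : x ∈ L) :
    IsIntegral2 (q ((2 : ℤ_[2]) • x) / 2) := by
  have h : q ((2 : ℤ_[2]) • x) / 2 = 2 * q x := by
    rw [two_smul ℤ_[2] x, ← two_smul ℚ_[2] x, QuadraticMap.map_smul, smul_eq_mul]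
    ring
  exact h ▸ IsIntegral2.two.mul (hLu.isIntegral2_map hx)

/-- The even sublattice has index at most two in a unimodular lattice. -/
lemma IsUnimodular.isIntegral2_half_map_add (hLu : IsUnimodular q L) {x y : V} (hx : x ∈ L)
    (hy : y ∈ L) (hx' : ¬ IsIntegral2 (q x / 2)) (hy' : ¬ IsIntegral2 (q y / 2)) :
    IsIntegral2 (q (x + y) / 2) := by
  have h : q (x + y) / 2 = (q x / 2 + q y / 2) + Bq q x y := by
    rw [map_add_eq_Bq]
    ring
  rw [h]
  refine IsIntegral2.add (IsIntegral2.add_of_two_mul ?_ hx' ?_ hy') (hLu.isIntegral2_Bq hx hy)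
  · rw [mul_div_cancel₀ _ two_ne_zero]
    exact hLu.isIntegral2_map hx
  · rw [mul_div_cancel₀ _ two_ne_zero]
    exact hLu.isIntegral2_map hy

/-- A vector of the dual of the even sublattice which pairs integrally with some odd vector of a
unimodular lattice lies in that lattice. -/
lemma IsUnimodular.mem_of_inDual_even (hLu : IsUnimodular q L)
    (hΛ : ∀ x, x ∈ Λ ↔ x ∈ L ∧ IsIntegral2 (q x / 2)) {v y : V} (hv : InDual q Λ v)
    (hy : y ∈ L) (hy' : ¬ IsIntegral2 (q y / 2)) (hvy : IsIntegral2 (Bq q v y)) : v ∈ L := by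
  refine (hLu v).1 fun z hz => ?_
  by_cases hz' : IsIntegral2 (q z / 2)
  · exact hv z ((hΛ z).2 ⟨hz, hz'⟩)
  · have h := hv (z + y) ((hΛ _).2 ⟨L.add_mem hz hy, hLu.isIntegral2_half_map_add hz hy hz' hy'⟩)
    rw [Bq_add_right] at h
    simpa using h.sub hvy

/-- Twice a vector of the dual of the even sublattice of a unimodular lattice lies in the
lattice. -/
lemma IsUnimodular.two_smul_mem_of_inDual_even (hLu : IsUnimodular q L)
    (hΛ : ∀ x, x ∈ Λ ↔ x ∈ L ∧ IsIntegral2 (q x / 2)) {v : V} (hv : InDual q Λ v) :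
    (2 : ℤ_[2]) • v ∈ L := by
  refine (hLu _).1 fun y hy => ?_
  have h := hv ((2 : ℤ_[2]) • y)
    ((hΛ _).2 ⟨L.smul_mem _ hy, hLu.isIntegral2_half_two_smul hy⟩)
  rw [padicInt_smul_eq, Bq_smul_right] at h
  rwa [padicInt_smul_eq, Bq_smul_left]

/-- If `(V, q)` contains an even unimodular lattice, the dual of the even sublattice of an odd
unimodular lattice `L` contains a vector outside `L` of even norm. -/
lemma IsUnimodular.exists_inDual_even_notMem (hnd : ∀ x : V, (∀ y : V, Bq q x y = 0) → x = 0)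
    (hL : IsLattice L) (hLu : IsUnimodular q L) (hodd : ¬ IsEvenLat q L)
    (hΛ : ∀ x, x ∈ Λ ↔ x ∈ L ∧ IsIntegral2 (q x / 2)) (hΛL : IsLattice Λ)
    {L' : Submodule ℤ_[2] V} (hL' : IsLattice L') (hLu' : IsUnimodular q L')
    (heven : IsEvenLat q L') :
    ∃ v, InDual q Λ v ∧ v ∉ L ∧ IsIntegral2 (q v / 2) := by
  obtain ⟨u, hu, huL⟩ : ∃ u, InDual q Λ u ∧ u ∉ L := by
    by_contra! hcon
    refine hodd fun x hx => ((hΛ x).1 ?_).2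
    exact hΛL.mem_of_forall_inDual hnd fun y hy => hLu.isIntegral2_Bq hx (hcon y hy)
  obtain ⟨l, hl, l', hl', rfl⟩ := Submodule.mem_sup.1 <|
    IsUnimodular.mem_sup_of_inDual_inf hnd hL hL' hLu hLu' (u := u)
      fun y hy => hu y ((hΛ y).2 ⟨hy.1, heven y hy.2⟩)
  refine ⟨l', fun y hy => ?_, fun h => huL (L.add_mem hl h), heven l' hl'⟩
  have h := hu y hy
  rw [Bq_add_left] at h
  simpa using h.sub (hLu.isIntegral2_Bq hl ((hΛ y).1 hy).1)

/-- If `v` lies in the dual of `Λ` and `Λ` and `v` have even norms, so has `Λ + ℤ₂v`. -/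
lemma isEvenLat_sup_span {v : V} (hΛ : IsEvenLat q Λ) (hv : InDual q Λ v)
    (hqv : IsIntegral2 (q v / 2)) : IsEvenLat q (Λ ⊔ Submodule.span ℤ_[2] {v}) := by
  intro x hx
  obtain ⟨y, hy, z, hz, rfl⟩ := Submodule.mem_sup.1 hx
  obtain ⟨a, rfl⟩ := Submodule.mem_span_singleton.1 hz
  refine IsIntegral2.half_map_add (hΛ y hy) (hqv.half_map_smul a) ?_
  rw [padicInt_smul_eq, Bq_smul_right, Bq_comm]
  exact (IsIntegral2.coe a).mul (hv y hy)

/-- An even lattice is contained in its dual. -/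
lemma IsEvenLat.isIntegral2_Bq (hL : IsEvenLat q L) {x y : V} (hx : x ∈ L) (hy : y ∈ L) :
    IsIntegral2 (Bq q x y) := by
  have h : Bq q x y = q (x + y) / 2 - q x / 2 - q y / 2 := by
    rw [Bq]
    ring
  exact h ▸ ((hL _ (L.add_mem hx hy)).sub (hL x hx)).sub (hL y hy)

/-- Adjoining to the even sublattice of an odd unimodular lattice `L` a vector of its dual, outside
`L` and of even norm, gives a unimodular lattice. -/
lemma IsUnimodular.isUnimodular_sup_span (hLu : IsUnimodular q L) (hodd : ¬ IsEvenLat q L)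
    (hΛ : ∀ x, x ∈ Λ ↔ x ∈ L ∧ IsIntegral2 (q x / 2)) {v : V} (hv : InDual q Λ v) (hvL : v ∉ L)
    (hqv : IsIntegral2 (q v / 2)) : IsUnimodular q (Λ ⊔ Submodule.span ℤ_[2] {v}) := by
  have hev : IsEvenLat q (Λ ⊔ Submodule.span ℤ_[2] {v}) :=
    isEvenLat_sup_span (fun x hx => ((hΛ x).1 hx).2) hv hqv
  have hvM : v ∈ Λ ⊔ Submodule.span ℤ_[2] {v} :=
    le_sup_right (a := Λ) (Submodule.mem_span_singleton_self v)
  obtain ⟨y, hy, hy'⟩ : ∃ y ∈ L, ¬ IsIntegral2 (q y / 2) := by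
    simpa [IsEvenLat] using hodd
  have two_mul : ∀ {w : V}, InDual q Λ w → IsIntegral2 (2 * Bq q w y) := by
    intro w hw
    have h := hLu.isIntegral2_Bq (hLu.two_smul_mem_of_inDual_even hΛ hw) hy
    rwa [padicInt_smul_eq, Bq_smul_left] at h
  have of_mem : ∀ {x : V}, InDual q (Λ ⊔ Submodule.span ℤ_[2] {v}) x → x ∈ L → x ∈ Λ := by
    intro x hx hxL
    refine (hΛ x).2 ⟨hxL, ?_⟩
    by_contra hx'
    exact hvL (hLu.mem_of_inDual_even hΛ hv hxL hx' (Bq_comm (q := q) x v ▸ hx v hvM))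
  refine fun x => ⟨fun hx => ?_, fun hx z hz => hev.isIntegral2_Bq hx hz⟩
  have hxΛ : InDual q Λ x := fun z hz => hx z (le_sup_left (a := Λ) hz)
  by_cases hxy : IsIntegral2 (Bq q x y)
  · exact le_sup_left (a := Λ) (of_mem hx (hLu.mem_of_inDual_even hΛ hxΛ hy hy' hxy))
  · have hvy : ¬ IsIntegral2 (Bq q v y) := fun h => hvL (hLu.mem_of_inDual_even hΛ hv hy hy' h)
    have hd : InDual q (Λ ⊔ Submodule.span ℤ_[2] {v}) (x + v) := by
      intro z hz
      rw [Bq_add_left]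
      exact (hx z hz).add (hev.isIntegral2_Bq hvM hz)
    have hxv : x + v ∈ L := by
      refine hLu.mem_of_inDual_even hΛ (fun z hz => hd z (le_sup_left (a := Λ) hz)) hy hy' ?_
      rw [Bq_add_left]
      exact IsIntegral2.add_of_two_mul (two_mul hxΛ) hxy (two_mul hv) hvy
    simpa using Submodule.sub_mem _ (le_sup_left (a := Λ) (of_mem hd hxv)) hvM

end Lattices

/-- Let `L` be an odd unimodular lattice in `(V, q)` over `ℚ₂` (`dim V ≥ 3`) and
`Λ = {x ∈ L : q(x) ∈ 2ℤ₂}`. If `(V, q)` contains an even unimodular lattice, then `Λ` is not a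
maximal lattice in `(V, ½q)`, and there is an even unimodular lattice `L_even` with
`Λ = L ∩ L_even` and `[L_even : Λ] = 2`. -/
theorem kernel_not_maximal_if_even_unimodular
    {V : Type*} [AddCommGroup V] [Module ℚ_[2] V] [Module ℤ_[2] V]
    [IsScalarTower ℤ_[2] ℚ_[2] V] [FiniteDimensional ℚ_[2] V]
    (d : ℕ) (hd : 3 ≤ d) (hdim : Module.finrank ℚ_[2] V = d)
    (q : QuadraticForm ℚ_[2] V)
    (hnd : ∀ x : V, (∀ y : V, Bq q x y = 0) → x = 0)
    (L : Submodule ℤ_[2] V) (hL : IsLattice L)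
    (hLuni : IsUnimodular q L) (hLodd : ¬ IsEvenLat q L)
    (Λ : Submodule ℤ_[2] V)
    (hΛ : (Λ : Set V) = {x : V | x ∈ L ∧ IsIntegral2 (q x / 2)})
    (heven : ∃ L' : Submodule ℤ_[2] V, IsLattice L' ∧ IsUnimodular q L' ∧ IsEvenLat q L') :
    ¬ IsMaximalLat (fun x : V => q x / 2) Λ ∧
      ∃ Lev : Submodule ℤ_[2] V, IsLattice Lev ∧ IsUnimodular q Lev ∧ IsEvenLat q Lev ∧
        (Λ : Set V) = (L : Set V) ∩ (Lev : Set V) ∧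
        Nat.card (↥Lev ⧸ Submodule.comap Lev.subtype Λ) = 2 := by
  have hΛ' : ∀ x, x ∈ Λ ↔ x ∈ L ∧ IsIntegral2 (q x / 2) := fun x => Set.ext_iff.1 hΛ x
  have hle : Λ ≤ L := fun x hx => ((hΛ' x).1 hx).1
  have hΛL : IsLattice Λ := hL.of_two_smul_mem hle fun x hx =>
    (hΛ' _).2 ⟨L.smul_mem _ hx, hLuni.isIntegral2_half_two_smul hx⟩
  obtain ⟨L', hL', hLu', hev'⟩ := heven
  obtain ⟨v, hv, hvL, hqv⟩ :=
    IsUnimodular.exists_inDual_even_notMem hnd hL hLuni hLodd hΛ' hΛL hL' hLu' hev'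
  have hvΛ : v ∉ Λ := fun h => hvL (hle h)
  have h2v : (2 : ℤ_[2]) • v ∈ Λ :=
    (hΛ' _).2 ⟨hLuni.two_smul_mem_of_inDual_even hΛ' hv, hqv.half_map_smul 2⟩
  have hvM : v ∈ Λ ⊔ Submodule.span ℤ_[2] {v} :=
    le_sup_right (a := Λ) (Submodule.mem_span_singleton_self v)
  have hM : IsLattice (Λ ⊔ Submodule.span ℤ_[2] {v}) :=
    ⟨hΛL.1.sup (Submodule.fg_span_singleton v),
      eq_top_iff.mpr (hΛL.2 ▸ Submodule.span_mono (le_sup_left (a := Λ)))⟩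
  have hMev : IsEvenLat q (Λ ⊔ Submodule.span ℤ_[2] {v}) :=
    isEvenLat_sup_span (fun x hx => ((hΛ' x).1 hx).2) hv hqv
  refine ⟨fun hmax => hmax.2 _ hM (lt_of_le_of_ne le_sup_left fun h => hvΛ (h ▸ hvM)) hMev,
    _, hM, hLuni.isUnimodular_sup_span hLodd hΛ' hv hvL hqv, hMev, ?_,
    card_quotient_sup_span_eq_two h2v hvΛ⟩
  refine Set.Subset.antisymm (fun x hx => ⟨hle hx, le_sup_left (a := Λ) hx⟩) ?_
  rintro x ⟨hxL, hxM⟩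
  exact (hΛ' x).2 ⟨hxL, hMev x hxM⟩
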